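/- arXiv:2309.13977 — 2 statements merged into one kernel-verified Lean document; each statement's English description precedes it below -/
import Mathlib

section
/- Let n ≥ 1 and, for each i ∈ {1,...,n}, let A_i ⊆ {1,...,n}. Suppose there exist subsets B_1 ⊊ B_2 ⊊ ... ⊊ B_m of {1,...,n} such that for every i ∈ {1,...,n} there is some ℓ ∈ {1,...,m} with i ∈ B_ℓ and B_ℓ ⊆ A_i. Then there exist functions w : {1,...,n} → ℕ (write times) and r : {1,...,n} × {1,...,n} → ℕ (read times) such that for all i, j ∈ {1,...,n}: w(i) < r(i,j), and j ∈ A_i if and only if w(j) < r(i,j). -/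
/-- Combinatorial restatement of Lemma 13 (valid collects): let `A i ⊆ Fin n` be
the support of the collect of process `i`. If there is a strictly increasing
chain of subsets `B 0 ⊊ B 1 ⊊ ... ⊊ B (m-1)` such that every process `i` belongs
to some `B ℓ` contained in `A i`, then the collects can be realized by a one-round
schedule: there are write times `w` and read times `r` with each process writing
before all of its reads, and a read of register `j` by process `i` returning the
written value (i.e. `j ∈ A i`) exactly when it occurs after `j`'s write. -/
theorem valid_collects (n : ℕ) (hn : 1 ≤ n) (A : Fin n → Set (Fin n))
    (m : ℕ) (B : Fin m → Finset (Fin n)) (hchain : StrictMono B)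
    (hcov : ∀ i : Fin n, ∃ ℓ : Fin m, i ∈ B ℓ ∧ ↑(B ℓ) ⊆ A i) :
    ∃ (w : Fin n → ℕ) (r : Fin n → Fin n → ℕ),
      ∀ i j : Fin n, w i < r i j ∧ (j ∈ A i ↔ w j < r i j) := by
  classical
  let w : Fin n → ℕ := fun j => (Finset.univ.filter fun k => j ∉ B k).card
  have hlt : ∀ i j, j ∉ A i → w i < w j := by
    intro i j hj
    obtain ⟨l, hil, hl⟩ := hcov i
    have hjl : j ∉ B l := fun h => hj (hl h)
    refine Finset.card_lt_card (Finset.ssubset_iff_of_subset ?_ |>.2 ⟨l, by simpa, by simpa⟩)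
    intro k hk
    simp only [Finset.mem_filter, Finset.mem_univ, true_and] at hk ⊢
    have hkl : k ≤ l := le_of_not_ge fun h => hk (hchain.monotone h hil)
    exact fun h => hjl (hchain.monotone hkl h)
  refine ⟨w, fun i j => if j ∈ A i then max (w i) (w j) + 1 else w j, fun i j => ?_⟩
  by_cases h : j ∈ A i
  · simp only [h, if_true, true_iff]
    omega
  · simpa [h] using hlt i j h
end

section
/- Let n and t be integers with 1 ≤ t and 2t < n. Let G be the simple graph on the vertex set ℤ/nℤ in which two distinct vertices u and v are adjacent if and only if v − u ∈ {±1, ±2, ..., ±(t+1)} in ℤ/nℤ. Then for every set F of vertices with |F| ≤ t, the subgraph of G induced on the complement of F is connected. -/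
/-- Among the `t + 1 ≤ n` vertices following `u` in `ℤ/nℤ`, at least one avoids a set of at most
`t` vertices. -/
theorem ZMod.exists_add_natCast_notMem {n t : ℕ} (hn : t + 1 ≤ n) (F : Finset (ZMod n))
    (hF : F.card ≤ t) (u : ZMod n) :
    ∃ d : ℕ, 1 ≤ d ∧ d ≤ t + 1 ∧ u + (d : ZMod n) ∉ F := by
  by_contra! h
  have hinj : Set.InjOn (fun d : ℕ => u + (d : ZMod n)) (Finset.Icc 1 (t + 1) : Finset ℕ) := by
    intro a ha b hb hab
    simp only [Finset.coe_Icc, Set.mem_Icc] at ha hb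
    have hmod : a ≡ b [MOD n] := (ZMod.natCast_eq_natCast_iff a b n).mp (add_left_cancel hab)
    rcases le_total a b with hle | hle
    · have hdvd := (Nat.modEq_iff_dvd' hle).mp hmod
      have := Nat.eq_zero_of_dvd_of_lt hdvd (by omega)
      omega
    · have hdvd := (Nat.modEq_iff_dvd' hle).mp hmod.symm
      have := Nat.eq_zero_of_dvd_of_lt hdvd (by omega)
      omega
  have hcard := Finset.card_le_card_of_injOn (s := Finset.Icc 1 (t + 1)) (t := F) _
    (fun d hd => h d (Finset.mem_Icc.mp hd).1 (Finset.mem_Icc.mp hd).2) hinj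
  rw [Nat.card_Icc] at hcard
  omega

/-- The `t`-augmented ring is `(t+1)`-connected: let `G` be the circulant graph
on `ℤ/nℤ` where two distinct vertices are adjacent iff their difference is
`±d` for some `1 ≤ d ≤ t+1`. If `1 ≤ t` and `2t < n`, then for every set `F`
of at most `t` vertices, the subgraph induced on the complement of `F` is
connected. -/
theorem augmented_ring_fault_tolerant_connected (n t : ℕ) (ht : 1 ≤ t)
    (hn : 2 * t < n) (G : SimpleGraph (ZMod n))
    (hG : ∀ u v : ZMod n, G.Adj u v ↔ u ≠ v ∧
      ∃ d : ℕ, 1 ≤ d ∧ d ≤ t + 1 ∧ (v - u = (d : ZMod n) ∨ u - v = (d : ZMod n)))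
    (F : Finset (ZMod n)) (hF : F.card ≤ t) :
    (G.induce ((↑F : Set (ZMod n))ᶜ)).Connected := by
  have hstep : ∀ (u v : ZMod n) (hu : u ∈ ((↑F : Set (ZMod n))ᶜ))
      (hv : v ∈ ((↑F : Set (ZMod n))ᶜ)) (d : ℕ), 1 ≤ d → d ≤ t + 1 → v = u + d →
      (G.induce ((↑F : Set (ZMod n))ᶜ)).Reachable ⟨u, hu⟩ ⟨v, hv⟩ := by
    intro u v hu hv d hd hdt huv
    by_cases h : u = v
    · subst h
      rfl
    · refine SimpleGraph.Adj.reachable ?_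
      rw [SimpleGraph.comap_adj]
      exact (hG u v).mpr ⟨h, d, hd, hdt, Or.inl (by rw [huv, add_sub_cancel_left])⟩
  have hreach : ∀ (k : ℕ) (u v : ZMod n) (hu : u ∈ ((↑F : Set (ZMod n))ᶜ))
      (hv : v ∈ ((↑F : Set (ZMod n))ᶜ)), v = u + k →
      (G.induce ((↑F : Set (ZMod n))ᶜ)).Reachable ⟨u, hu⟩ ⟨v, hv⟩ := by
    intro k
    induction k using Nat.strong_induction_on with
    | _ k ih =>
      intro u v hu hv huv
      rcases Nat.eq_zero_or_pos k with rfl | hk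
      · obtain rfl : v = u := by simpa using huv
        rfl
      by_cases hkt : k ≤ t + 1
      · exact hstep u v hu hv k hk hkt huv
      obtain ⟨d, hd, hdt, hdF⟩ :=
        ZMod.exists_add_natCast_notMem (by omega : t + 1 ≤ n) F hF u
      have hw : u + (d : ZMod n) ∈ ((↑F : Set (ZMod n))ᶜ) := by simpa using hdF
      refine (hstep u _ hu hw d hd hdt rfl).trans (ih (k - d) (by omega) _ v hw hv ?_)
      rw [huv, Nat.cast_sub (by omega)]
      ring
  have : NeZero n := ⟨by omega⟩
  obtain ⟨d, -, -, hdF⟩ := ZMod.exists_add_natCast_notMem (by omega : t + 1 ≤ n) F hF 0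
  have : Nonempty ↥((↑F : Set (ZMod n))ᶜ) := ⟨⟨0 + (d : ZMod n), by simpa using hdF⟩⟩
  refine SimpleGraph.Connected.mk ?_
  rintro ⟨u, hu⟩ ⟨v, hv⟩
  exact hreach (v - u).val u v hu hv (by rw [ZMod.natCast_zmod_val]; ring)
end
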